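/- arXiv:2011.02224 — 13 statements merged into one kernel-verified Lean document; each statement's English description precedes it below -/
import Mathlib

section
/- Let n be a natural number with n > 2, let s : ZMod n → Bool and L : ZMod n → ZMod (n^2). Suppose that for every k : ZMod n: if s k = true then L k = L (k + 1) + (n - 1) in ZMod (n^2), and if s k = false then L (k + 1) = L k + 1 in ZMod (n^2). Then there is exactly one k : ZMod n with s k = true (i.e., the finset of k with s k = true has cardinality 1). -/
/-- If `L` increases by `1` along every edge of a ring of size `n`, except for a drop by `n - 1` at
each token, then going once around the ring shows that `n = c * n`, with `c` the token count. -/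
theorem natCast_eq_card_mul_of_ring_labeling {n : ℕ} [NeZero n] {R : Type*} [Ring R]
    (s : ZMod n → Bool) (L : ZMod n → R)
    (h1 : ∀ k : ZMod n, s k = true → L k = L (k + 1) + ((n : R) - 1))
    (h2 : ∀ k : ZMod n, s k = false → L (k + 1) = L k + 1) :
    (n : R) = (Finset.univ.filter (fun k : ZMod n => s k = true)).card * (n : R) := by
  have hstep (k : ZMod n) : L (k + 1) + (if s k = true then (n : R) else 0) = L k + 1 := by
    cases hk : s k
    · simp [h2 k hk]
    · rw [h1 k hk]
      simp [add_assoc]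
  have hshift : ∑ k : ZMod n, L (k + 1) = ∑ k : ZMod n, L k :=
    Equiv.sum_comp (Equiv.addRight (1 : ZMod n)) L
  have hsum := Finset.sum_congr (rfl : (Finset.univ : Finset (ZMod n)) = _) fun k _ => hstep k
  rw [Finset.sum_add_distrib, Finset.sum_add_distrib, hshift, ← Finset.sum_filter] at hsum
  simpa [ZMod.card] using (add_left_cancel hsum).symm

theorem ring_rpls_soundness (n : ℕ) (hn : 2 < n) (s : ZMod n → Bool)
    (L : ZMod n → ZMod (n ^ 2))
    (h1 : ∀ k : ZMod n, s k = true → L k = L (k + 1) + ((n : ZMod (n ^ 2)) - 1))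
    (h2 : ∀ k : ZMod n, s k = false → L (k + 1) = L k + 1) :
    haveI : NeZero n := ⟨by omega⟩
    (Finset.univ.filter (fun k : ZMod n => s k = true)).card = 1 := by
  have : NeZero n := ⟨by omega⟩
  have hcard := natCast_eq_card_mul_of_ring_labeling s L h1 h2
  have hle : (Finset.univ.filter (fun k : ZMod n => s k = true)).card ≤ n := by
    simpa [ZMod.card] using Finset.card_le_univ (Finset.univ.filter fun k : ZMod n => s k = true)
  generalize (Finset.univ.filter (fun k : ZMod n => s k = true)).card = c at hcard hle ⊢
  have hmod : 1 * n ≡ c * n [MOD n * n] := by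
    rw [← sq, ← ZMod.natCast_eq_natCast_iff]
    simpa using hcard
  have hmod' : 1 ≡ c [MOD n] := Nat.ModEq.mul_right_cancel' (by omega) hmod
  obtain rfl | hlt := hle.eq_or_lt
  · have := hmod'.trans (Nat.modEq_zero_iff_dvd.mpr dvd_rfl)
    exact absurd (this.eq_of_lt_of_lt (by omega) (by omega)) one_ne_zero
  · exact (hmod'.eq_of_lt_of_lt (by omega) hlt).symm
end

section
/- Let n be a natural number with n > 2, let j : ZMod n and L : ZMod n → ZMod (n^2). Suppose L j = L (j + 1) + (n - 1) in ZMod (n^2) and L (k + 1) = L k + 1 for every k ≠ j. Let L' = Function.update L (j + 1) (L j + 1). Then L' (j + 1) = L' (j + 2) + (n - 1) in ZMod (n^2), and L' (k + 1) = L' k + 1 for every k ≠ j + 1. -/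
theorem ring_rpls_pass_clockwise (n : ℕ) (hn : 2 < n) (j : ZMod n)
    (L : ZMod n → ZMod (n ^ 2))
    (h1 : L j = L (j + 1) + ((n : ZMod (n ^ 2)) - 1))
    (h2 : ∀ k : ZMod n, k ≠ j → L (k + 1) = L k + 1) :
    let L' := Function.update L (j + 1) (L j + 1)
    L' (j + 1) = L' (j + 2) + ((n : ZMod (n ^ 2)) - 1) ∧
      ∀ k : ZMod n, k ≠ j + 1 → L' (k + 1) = L' k + 1 := by
  intro L'
  have : Fact (1 < n) := ⟨by omega⟩
  have hj : j + 1 ≠ j := by simp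
  have hadd : j + 2 = j + 1 + 1 := by ring
  have hj2 : j + 2 ≠ j + 1 := by rw [hadd]; simp
  refine ⟨?_, fun k hk => ?_⟩
  · have hL : L (j + 2) = L (j + 1) + 1 := by rw [hadd, h2 _ hj]
    simp only [L', Function.update_self, Function.update_of_ne hj2]
    rw [hL, h1]
    ring
  · by_cases hkj : k = j
    · subst hkj
      simp only [L', Function.update_self, Function.update_of_ne hk]
    · have hk1 : k + 1 ≠ j + 1 := fun h => hkj (add_right_cancel h)
      simp only [L', Function.update_of_ne hk1, Function.update_of_ne hk]
      exact h2 k hkj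
end

section
/- Let n be a natural number with n > 2, let j : ZMod n and L : ZMod n → ZMod (n^2). Suppose L j = L (j + 1) + (n - 1) in ZMod (n^2) and L (k + 1) = L k + 1 for every k ≠ j. Let L' = Function.update L j (L (j - 1) - (n - 1)). Then L' (j - 1) = L' j + (n - 1) in ZMod (n^2), and L' (k + 1) = L' k + 1 for every k ≠ j - 1. -/
theorem ring_rpls_pass_counterclockwise (n : ℕ) (hn : 2 < n) (j : ZMod n)
    (L : ZMod n → ZMod (n ^ 2))
    (h1 : L j = L (j + 1) + ((n : ZMod (n ^ 2)) - 1))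
    (h2 : ∀ k : ZMod n, k ≠ j → L (k + 1) = L k + 1) :
    let L' := Function.update L j (L (j - 1) - ((n : ZMod (n ^ 2)) - 1))
    L' (j - 1) = L' j + ((n : ZMod (n ^ 2)) - 1) ∧
      ∀ k : ZMod n, k ≠ j - 1 → L' (k + 1) = L' k + 1 := by
  intro L'
  have : Fact (1 < n) := ⟨by lia⟩
  have pred_ne : j - 1 ≠ j := by simp
  have succ_ne : j + 1 ≠ j := by simp
  refine ⟨by simp [L'], fun k hk => ?_⟩
  by_cases hkj : k = j
  · subst hkj
    have h := h2 (k - 1) pred_ne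
    rw [sub_add_cancel] at h
    simp only [L', Function.update_self, Function.update_of_ne succ_ne]
    linear_combination h - h1
  · have hkj' : k + 1 ≠ j := fun h => hk (eq_sub_of_add_eq h)
    simp only [L', Function.update_of_ne hkj, Function.update_of_ne hkj']
    exact h2 k hkj
end

section
/- Let V be a finite type and G : SimpleGraph V with G.IsTree. Let D : V → V → Prop satisfy: (i) D u v implies G.Adj u v; (ii) for all u, v with G.Adj u v, exactly one of D u v and D v u holds; (iii) every vertex v has at most one vertex u with D v u. Then there is exactly one vertex v such that no u satisfies D v u. -/
theorem tree_orientation_unique_sink (V : Type*) [Fintype V] (G : SimpleGraph V)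
    (hG : G.IsTree) (D : V → V → Prop)
    (h1 : ∀ u v : V, D u v → G.Adj u v)
    (h2 : ∀ u v : V, G.Adj u v → Xor' (D u v) (D v u))
    (h3 : ∀ v u w : V, D v u → D v w → u = w) :
    ∃! v : V, ∀ u : V, ¬ D v u := by
  classical
  -- Sending each non-sink to its outgoing edge is a bijection onto the edges.
  choose f hf using fun v : {v : V // ∃ u, D v u} => v.2
  have hbij : Function.Bijective
      (fun v => (⟨s(v.1, f v), h1 _ _ (hf v)⟩ : G.edgeSet)) := by
    constructor
    · intro v w hvw
      have h : s(v.1, f v) = s(w.1, f w) := congrArg Subtype.val hvw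
      rcases Sym2.eq_iff.mp h with ⟨h, -⟩ | ⟨h, h'⟩
      · exact Subtype.ext h
      · have hv := hf v
        have hw := hf w
        rw [h'] at hv
        rw [← h] at hw
        rcases h2 _ _ (h1 _ _ hv) with ⟨-, hn⟩ | ⟨-, hn⟩
        · exact absurd hw hn
        · exact absurd hv hn
    · rintro ⟨e, he⟩
      induction e with
      | _ u v =>
        rcases h2 u v he with ⟨h, -⟩ | ⟨h, -⟩
        · exact ⟨⟨u, v, h⟩, Subtype.ext (by simp [h3 _ _ _ (hf ⟨u, v, h⟩) h])⟩
        · exact ⟨⟨v, u, h⟩, Subtype.ext (by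
            simp [h3 _ _ _ (hf ⟨v, u, h⟩) h, Sym2.eq_swap])⟩
  have hcard : Fintype.card {v : V // ∃ u, D v u} = Fintype.card G.edgeSet :=
    Fintype.card_of_bijective hbij
  have htree := hG.card_edgeFinset
  rw [SimpleGraph.edgeFinset_card] at htree
  have hcompl := Fintype.card_subtype_compl (fun v : V => ∃ u, D v u)
  have hone : Fintype.card {v : V // ¬ ∃ u, D v u} = 1 := by omega
  obtain ⟨⟨v, hv⟩, huniq⟩ := Fintype.card_eq_one_iff.mp hone
  exact ⟨v, not_exists.mp hv, fun w hw =>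
    congrArg Subtype.val (huniq ⟨w, not_exists.mpr hw⟩)⟩
end

section
/- Let V be a finite type and G : SimpleGraph V with G.IsTree. There is no function f : V → V such that G.Adj v (f v) for every v : V and f (f v) ≠ v for every v : V. -/
theorem tree_no_all_outgoing (V : Type*) [Fintype V] (G : SimpleGraph V)
    (hG : G.IsTree) :
    ¬ ∃ f : V → V, (∀ v : V, G.Adj v (f v)) ∧ (∀ v : V, f (f v) ≠ v) := by
  classical
  rintro ⟨f, hadj, hne⟩
  have hinj : Function.Injective fun v => s(v, f v) := by
    intro v w h
    rcases Sym2.eq_iff.mp h with ⟨hvw, -⟩ | ⟨hv, hw⟩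
    · exact hvw
    · exact absurd (hw ▸ hv.symm) (hne v)
  have hle : Fintype.card V ≤ G.edgeFinset.card :=
    Finset.card_le_card_of_injOn (fun v => s(v, f v))
      (fun v _ => by simpa using hadj v) hinj.injOn
  have hcard := hG.card_edgeFinset
  omega
end

section
/- Let V be a finite type, G : SimpleGraph V with G.IsTree, w : V → V → ZMod 3 and s : V → Prop. Assume: (C1) for every v with s v and every u with G.Adj u v, w u v = w v u + 1 in ZMod 3; (C2) for every v with ¬ s v, there exists u with G.Adj v u and w v u = w u v + 1 such that for every x with G.Adj v x and x ≠ u, w x v = w v x + 1. Then there exists exactly one v : V with s v. -/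
/-- In `ZMod 3`, an edge cannot be directed both ways. -/
theorem ZMod.ne_add_one_of_eq_add_one {a b : ZMod 3} (h : a = b + 1) : b ≠ a + 1 := by
  revert a b
  decide

theorem tree_rpls_soundness (V : Type*) [Fintype V] (G : SimpleGraph V)
    (hG : G.IsTree) (w : V → V → ZMod 3) (s : V → Prop)
    (hC1 : ∀ v : V, s v → ∀ u : V, G.Adj u v → w u v = w v u + 1)
    (hC2 : ∀ v : V, ¬ s v → ∃ u : V, G.Adj v u ∧ w v u = w u v + 1 ∧
      ∀ x : V, G.Adj v x → x ≠ u → w x v = w v x + 1) :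
    ∃! v : V, s v := by
  classical
  choose! out hadj hout hin using hC2
  -- Sending a tokenless node to its outgoing edge is a bijection onto the edges.
  let f : {v // ¬ s v} → G.edgeSet := fun v => ⟨s(v.1, out v.1), hadj v.1 v.2⟩
  have hinj : Function.Injective f := by
    rintro ⟨a, ha⟩ ⟨b, hb⟩ hab
    rcases Sym2.eq_iff.mp (congrArg Subtype.val hab) with ⟨h, -⟩ | ⟨h, h'⟩
    · exact Subtype.ext h
    · have hoa := hout a ha
      have hob := hout b hb
      rw [h'] at hoa
      rw [← h] at hob
      exact absurd hob (ZMod.ne_add_one_of_eq_add_one hoa)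
  have hmem : ∀ a b, G.Adj a b → w a b = w b a + 1 → ∃ v, (f v).1 = s(a, b) := by
    intro a b hab hw
    have ha : ¬ s a := fun ha => ZMod.ne_add_one_of_eq_add_one hw (hC1 a ha b hab.symm)
    have hb : b = out a := by
      by_contra hne
      exact ZMod.ne_add_one_of_eq_add_one hw (hin a ha b hab hne)
    exact ⟨⟨a, ha⟩, by rw [hb]⟩
  have hdir : ∀ a b, G.Adj a b → w a b = w b a + 1 ∨ w b a = w a b + 1 := by
    intro a b hab
    by_cases ha : s a
    · exact Or.inr (hC1 a ha b hab.symm)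
    · by_cases hb : b = out a
      · exact Or.inl (hb ▸ hout a ha)
      · exact Or.inr (hin a ha b hab hb)
  have hsurj : Function.Surjective f := by
    rintro ⟨⟨a, b⟩, hab⟩
    rcases hdir a b hab with hw | hw
    · obtain ⟨v, hv⟩ := hmem a b hab hw
      exact ⟨v, Subtype.ext hv⟩
    · obtain ⟨v, hv⟩ := hmem b a hab.symm hw
      exact ⟨v, Subtype.ext (hv.trans Sym2.eq_swap)⟩
  have hcard : Fintype.card {v // ¬ s v} = Fintype.card G.edgeSet :=
    Fintype.card_of_bijective ⟨hinj, hsurj⟩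
  have hedges := hG.card_edgeFinset
  rw [SimpleGraph.edgeFinset_card, ← hcard] at hedges
  have hcompl := Fintype.card_subtype_compl s
  have hle := Fintype.card_subtype_le s
  have hone : Fintype.card {v // s v} = 1 := by omega
  obtain ⟨⟨v, hv⟩, huniq⟩ := Fintype.card_eq_one_iff.mp hone
  exact ⟨v, hv, fun y hy => congrArg Subtype.val (huniq ⟨y, hy⟩)⟩
end

section
/- Let V be a finite type, G : SimpleGraph V with G.IsTree, and v₀ : V. Then there exists w : V → V → ZMod 3 such that: (i) for every u with G.Adj u v₀, w u v₀ = w v₀ u + 1 in ZMod 3; and (ii) for every v ≠ v₀ there exists u with G.Adj v u and w v u = w u v + 1 such that for every x with G.Adj v x and x ≠ u, w x v = w v x + 1. -/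
namespace SimpleGraph

theorem IsTree.eq_of_adj_of_dist_eq_add_one {V : Type*} {G : SimpleGraph V} (hG : G.IsTree)
    {v₀ v x y : V} (hx : G.Adj v x) (hy : G.Adj v y)
    (hdx : G.dist v v₀ = G.dist x v₀ + 1) (hdy : G.dist v v₀ = G.dist y v₀ + 1) : x = y := by
  obtain ⟨p, hp⟩ := hG.connected.exists_walk_length_eq_dist x v₀
  obtain ⟨q, hq⟩ := hG.connected.exists_walk_length_eq_dist y v₀
  have hp' : (Walk.cons hx p).IsPath := Walk.isPath_of_length_eq_dist _ (by simp [hp, hdx])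
  have hq' : (Walk.cons hy q).IsPath := Walk.isPath_of_length_eq_dist _ (by simp [hq, hdy])
  simpa using congrArg Walk.snd ((hG.existsUnique_path v v₀).unique hp' hq')

theorem Connected.exists_adj_dist_eq_add_one {V : Type*} {G : SimpleGraph V} (hG : G.Connected)
    {v v₀ : V} (h : v ≠ v₀) : ∃ u, G.Adj v u ∧ G.dist v v₀ = G.dist u v₀ + 1 := by
  obtain ⟨p, hp⟩ := hG.exists_walk_length_eq_dist v v₀
  cases p with
  | nil => exact absurd rfl h
  | @cons _ u _ hu p =>
    refine ⟨u, hu, ?_⟩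
    have h₁ := dist_le p
    have h₂ := hG.dist_triangle (u := v) (v := u) (w := v₀)
    rw [dist_eq_one_iff_adj.mpr hu] at h₂
    rw [Walk.length_cons] at hp
    omega

end SimpleGraph

theorem tree_rpls_initial_labeling (V : Type*) [Fintype V] (G : SimpleGraph V)
    (hG : G.IsTree) (v₀ : V) :
    ∃ w : V → V → ZMod 3,
      (∀ u : V, G.Adj u v₀ → w u v₀ = w v₀ u + 1) ∧
      ∀ v : V, v ≠ v₀ → ∃ u : V, G.Adj v u ∧ w v u = w u v + 1 ∧
        ∀ x : V, G.Adj v x → x ≠ u → w x v = w v x + 1 := by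
  refine ⟨fun v _ => (G.dist v v₀ : ZMod 3), fun u hu => ?_, fun v hv => ?_⟩
  · simp [SimpleGraph.dist_eq_one_iff_adj.mpr hu]
  · obtain ⟨u, hu, hd⟩ := hG.connected.exists_adj_dist_eq_add_one hv
    refine ⟨u, hu, by simp [hd], fun x hx hxu => ?_⟩
    have h := hG.dist_eq_dist_add_one_of_adj v₀ hx
    rw [SimpleGraph.dist_comm (u := v₀) (v := v), SimpleGraph.dist_comm (u := v₀) (v := x)] at h
    rcases h with h | h
    · exact absurd (hG.eq_of_adj_of_dist_eq_add_one hx hu h hd) hxu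
    · simp [h]
end

section
/- Let V be a finite type, G : SimpleGraph V with G.IsTree, w : V → V → ZMod 3, and let u, v : V with G.Adj u v. Assume: (i) for every x with G.Adj x u, w x u = w u x + 1 in ZMod 3; and (ii) for every p ≠ u there exists q with G.Adj p q and w p q = w q p + 1 such that for every x with G.Adj p x and x ≠ q, w x p = w p x + 1. Define w' : V → V → ZMod 3 by w' x y = if x = v ∧ y = u then w u v - 1 else w x y. Then: (i') for every x with G.Adj x v, w' x v = w' v x + 1; and (ii') for every p ≠ v there exists q with G.Adj p q and w' p q = w' q p + 1 such that for every x with G.Adj p x and x ≠ q, w' x p = w' p x + 1. -/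
theorem tree_rpls_pass_token (V : Type*) [Fintype V] [DecidableEq V]
    (G : SimpleGraph V) (hG : G.IsTree) (w : V → V → ZMod 3) (u v : V)
    (huv : G.Adj u v)
    (hi : ∀ x : V, G.Adj x u → w x u = w u x + 1)
    (hii : ∀ p : V, p ≠ u → ∃ q : V, G.Adj p q ∧ w p q = w q p + 1 ∧
      ∀ x : V, G.Adj p x → x ≠ q → w x p = w p x + 1) :
    let w' : V → V → ZMod 3 := fun x y => if x = v ∧ y = u then w u v - 1 else w x y
    (∀ x : V, G.Adj x v → w' x v = w' v x + 1) ∧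
      ∀ p : V, p ≠ v → ∃ q : V, G.Adj p q ∧ w' p q = w' q p + 1 ∧
        ∀ x : V, G.Adj p x → x ≠ q → w' x p = w' p x + 1 := by
  intro w'
  have h_ne : u ≠ v := huv.ne
  have h_vu : w' v u = w u v - 1 := by simp [w']
  have h_row : ∀ x y, x ≠ v → w' x y = w x y := fun x y hx => by simp [w', hx]
  have h_col : ∀ x y, y ≠ u → w' x y = w x y := fun x y hy => by simp [w', hy]
  refine ⟨fun x hx => ?_, fun p hp => ?_⟩
  · rw [h_col x v h_ne.symm]
    obtain rfl | hxu := eq_or_ne x u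
    · rw [h_vu, sub_add_cancel]
    · rw [h_col v x hxu]
      obtain ⟨q, -, -, h_in⟩ := hii v h_ne.symm
      -- The edge between `u` and `v` points to `u`, so `u` is the unique out-neighbor of `v`.
      obtain rfl : u = q := by
        by_contra huq
        have h₁ := h_in u huv.symm huq
        rw [hi v huv.symm, add_assoc, left_eq_add] at h₁
        exact absurd h₁ (by decide)
      exact h_in x hx.symm hxu
  · obtain rfl | hpu := eq_or_ne p u
    · refine ⟨v, huv, ?_, fun x hx hxv => ?_⟩
      · rw [h_row p v hp, h_vu, sub_add_cancel]
      · rw [h_row x p hxv, h_row p x hp]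
        exact hi x hx.symm
    · obtain ⟨q, hpq, h_out, h_in⟩ := hii p hpu
      refine ⟨q, hpq, ?_, fun x hx hxq => ?_⟩
      · rw [h_row p q hp, h_col q p hpu]
        exact h_out
      · rw [h_row p x hp, h_col x p hpu]
        exact h_in x hx hxq
end

section
/- Let V be a finite type, G : SimpleGraph V with G.Connected, and let root : V → V, par : V → Option V, dist : V → ℕ. Define f : V → V by f v = (par v).getD v. Assume: (S1) for all u, v with G.Adj u v, root u = root v; (S2) for every v with root v = v, par v = none and dist v = 0; (S3) for every v with root v ≠ v, there exists u with G.Adj v u, par v = some u, and dist v = dist u + 1. Then there exists r : V such that root v = r for every v, par r = none, and for every v there exists m : ℕ with f^[m] v = r. -/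
/-- A labelling that agrees across every edge agrees at the two ends of a walk. -/
theorem root_eq_of_walk {V α : Type*} {G : SimpleGraph V} {root : V → α}
    (h : ∀ u v : V, G.Adj u v → root u = root v) {u v : V} (p : G.Walk u v) :
    root u = root v := by
  induction p with
  | nil => rfl
  | cons hadj _ ih => exact (h _ _ hadj).trans ih

theorem checkST_soundness (V : Type*) [Fintype V] (G : SimpleGraph V)
    (hG : G.Connected) (root : V → V) (par : V → Option V) (dist : V → ℕ)
    (hS1 : ∀ u v : V, G.Adj u v → root u = root v)
    (hS2 : ∀ v : V, root v = v → par v = none ∧ dist v = 0)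
    (hS3 : ∀ v : V, root v ≠ v →
      ∃ u : V, G.Adj v u ∧ par v = some u ∧ dist v = dist u + 1) :
    let f : V → V := fun v => (par v).getD v
    ∃ r : V, (∀ v : V, root v = r) ∧ par r = none ∧
      ∀ v : V, ∃ m : ℕ, f^[m] v = r := by
  intro f
  obtain ⟨x⟩ := hG.nonempty
  have h_root : ∀ v, root v = root x := fun v => by
    obtain ⟨p⟩ := hG.preconnected v x
    exact root_eq_of_walk hS1 p
  refine ⟨root x, h_root, (hS2 _ (h_root _)).1, fun v => ?_⟩
  induction hd : dist v generalizing v with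
  | zero =>
    by_cases hv : root v = v
    · exact ⟨0, hv.symm.trans (h_root v)⟩
    · obtain ⟨u, -, -, hu⟩ := hS3 v hv
      omega
  | succ n ih =>
    by_cases hv : root v = v
    · exact ⟨0, hv.symm.trans (h_root v)⟩
    · obtain ⟨u, -, hp, hu⟩ := hS3 v hv
      obtain ⟨m, hm⟩ := ih u (by omega)
      have hf : f v = u := by simp [f, hp]
      exact ⟨m + 1, by rw [Function.iterate_succ_apply, hf, hm]⟩
end

section
/- Let V be a finite type with n = Fintype.card V, let r : V and p : V → V with p r = r, and assume that for every v : V there exists k ≤ n - 1 with p^[k] v = r. Define d : ℕ → V → Option ℕ by d 0 v = (if v = r then some 0 else none) and d (t+1) v = (if v = r then some 0 else Option.map (· + 1) (d t (p v))). Then for every v : V, d (n - 1) v = some (depth v), where depth v is the least k : ℕ with p^[k] v = r. -/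
/-- Distributed distance propagation on a rooted parent structure: at round `t + 1`,
the root knows distance `0` and every other vertex increments the distance its
parent knew at round `t`. -/
def candDist {V : Type*} [DecidableEq V] (r : V) (p : V → V) : ℕ → V → Option ℕ
  | 0, v => if v = r then some 0 else none
  | t + 1, v => if v = r then some 0 else Option.map (· + 1) (candDist r p t (p v))

theorem candDist_eq_some {V : Type*} [DecidableEq V] {r : V} {p : V → V} {t k : ℕ} {v : V}
    (hkt : k ≤ t) (hk : p^[k] v = r) (hmin : ∀ j < k, p^[j] v ≠ r) :
    candDist r p t v = some k := by
  induction k generalizing t v with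
  | zero =>
    have hv : v = r := hk
    cases t <;> simp [candDist, hv]
  | succ k ih =>
    obtain ⟨t, rfl⟩ := Nat.exists_eq_add_of_le' hkt
    have hv : v ≠ r := hmin 0 k.succ_pos
    have hp : candDist r p (t + k) (p v) = some k :=
      ih (Nat.le_add_left k t) hk fun j hj => hmin (j + 1) (Nat.succ_lt_succ hj)
    simp [candDist, hv, hp]

theorem cand_tree_labeled_by_checkpoint (V : Type*) [Fintype V] [DecidableEq V]
    (r : V) (p : V → V) (hr : p r = r)
    (h : ∀ v : V, ∃ k ≤ Fintype.card V - 1, p^[k] v = r) :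
    ∀ v : V, candDist r p (Fintype.card V - 1) v =
      some (Nat.find (⟨(h v).choose, (h v).choose_spec.2⟩ : ∃ k : ℕ, p^[k] v = r)) := by
  intro v
  obtain ⟨k, hkn, hk⟩ := h v
  exact candDist_eq_some ((Nat.find_min' _ hk).trans hkn) (Nat.find_spec (⟨k, hk⟩ : ∃ k, p^[k] v = r))
    fun _ hj => Nat.find_min _ hj
end

section
/- Let V be a finite type with decidable equality, let v₀ : V, R : ℕ, tin tout : V → Finset (ℕ × V), and s : V → Bool. For v : V and t : ℕ, let A v t be the number of entries (r, u) ∈ tin v with r ≤ t, let B v t be the number of entries (r, u) ∈ tout v with r ≤ t, and define bal v t = (if v = v₀ then 1 else 0) + (A v t : ℤ) - (B v t : ℤ). Assume: (H0) every entry (r, u) of tin v or of tout v satisfies 1 ≤ r and r ≤ R; (H2) for every v and every t, 0 ≤ bal v t and bal v t ≤ 1, and moreover s v = true if and only if bal v R = 1; (H3) for all v, u : V and r : ℕ, (r, u) ∈ tout v if and only if (r, v) ∈ tin u. Then there exists exactly one v : V with s v = true. -/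
/-- The token balance of node `v` up to round `t`: the indicator that `v` held the
token at the checkpoint, plus the number of logged token receptions of round `≤ t`,
minus the number of logged token transmissions of round `≤ t`. -/
def tokenBal {V : Type*} [DecidableEq V] (v₀ : V) (tin tout : V → Finset (ℕ × V))
    (v : V) (t : ℕ) : ℤ :=
  (if v = v₀ then 1 else 0) + (((tin v).filter (fun e => e.1 ≤ t)).card : ℤ)
    - (((tout v).filter (fun e => e.1 ≤ t)).card : ℤ)

/-- If every transmission is logged by its receiver and conversely, then up to any round
the network as a whole logs as many receptions as transmissions. -/
theorem sum_card_received_eq_sum_card_sent {V : Type*} [Fintype V]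
    {tin tout : V → Finset (ℕ × V)}
    (h : ∀ (v u : V) (r : ℕ), (r, u) ∈ tout v ↔ (r, v) ∈ tin u) (t : ℕ) :
    ∑ v, ((tin v).filter (fun e => e.1 ≤ t)).card =
      ∑ v, ((tout v).filter (fun e => e.1 ≤ t)).card := by
  rw [← Finset.card_sigma, ← Finset.card_sigma]
  refine Finset.card_bij' (fun x _ => ⟨x.2.2, (x.2.1, x.1)⟩) (fun x _ => ⟨x.2.2, (x.2.1, x.1)⟩)
    ?_ ?_ (fun _ _ => rfl) (fun _ _ => rfl)
  · rintro ⟨v, r, u⟩ hx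
    simpa [h] using hx
  · rintro ⟨v, r, u⟩ hx
    simpa [h] using hx

/-- Consistent logs conserve the token: the balances always add up to `1`. -/
theorem sum_tokenBal {V : Type*} [Fintype V] [DecidableEq V] (v₀ : V)
    {tin tout : V → Finset (ℕ × V)}
    (h : ∀ (v u : V) (r : ℕ), (r, u) ∈ tout v ↔ (r, v) ∈ tin u) (t : ℕ) :
    ∑ v, tokenBal v₀ tin tout v t = 1 := by
  have hsum := sum_card_received_eq_sum_card_sent h t
  simp only [tokenBal, Finset.sum_sub_distrib, Finset.sum_add_distrib, ← Nat.cast_sum, hsum]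
  simp

/-- A nonnegative integer-valued family bounded by `1` with sum `1` takes the value `1`
exactly once. -/
theorem existsUnique_eq_one_of_sum_eq_one {ι : Type*} [Fintype ι] {f : ι → ℤ}
    (h0 : ∀ i, 0 ≤ f i) (h1 : ∀ i, f i ≤ 1) (hsum : ∑ i, f i = 1) : ∃! i, f i = 1 := by
  classical
  obtain ⟨i, -, hi⟩ := Finset.exists_ne_zero_of_sum_ne_zero (hsum.trans_ne one_ne_zero)
  have hi1 : f i = 1 := by have := h0 i; have := h1 i; omega
  refine ⟨i, hi1, fun j hj => ?_⟩
  by_contra hne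
  have hle : ∑ k ∈ {j, i}, f k ≤ ∑ k, f k :=
    Finset.sum_le_sum_of_subset_of_nonneg (Finset.subset_univ _) fun k _ _ => h0 k
  rw [Finset.sum_pair hne, hsum, hi1, hj] at hle
  omega

theorem general_rpls_soundness (V : Type*) [Fintype V] [DecidableEq V]
    (v₀ : V) (R : ℕ) (tin tout : V → Finset (ℕ × V)) (s : V → Bool)
    (hH0 : ∀ (v u : V) (r : ℕ), ((r, u) ∈ tin v ∨ (r, u) ∈ tout v) → 1 ≤ r ∧ r ≤ R)
    (hH2 : ∀ (v : V) (t : ℕ),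
      0 ≤ tokenBal v₀ tin tout v t ∧ tokenBal v₀ tin tout v t ≤ 1)
    (hH2' : ∀ v : V, s v = true ↔ tokenBal v₀ tin tout v R = 1)
    (hH3 : ∀ (v u : V) (r : ℕ), (r, u) ∈ tout v ↔ (r, v) ∈ tin u) :
    ∃! v : V, s v = true := by
  simp only [hH2']
  exact existsUnique_eq_one_of_sum_eq_one (fun v => (hH2 v R).1) (fun v => (hH2 v R).2)
    (sum_tokenBal v₀ hH3 R)
end

section
/- Let X and n be natural numbers with 0 < X and 1 ≤ n, let v₀ : ZMod X and d : ZMod X → ℕ. Suppose d v₀ = 0, d (v₀ - 1) = n - 1, and for every k : ZMod X with k ≠ v₀, d k = d (k - 1) + 1. Then X = n. -/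
/-- Labels that vanish at `v₀` and increase by one along every other step of a directed ring
are the clockwise distances from `v₀`. -/
theorem ZMod.label_add_natCast {X : ℕ} {v₀ : ZMod X} {d : ZMod X → ℕ} (h0 : d v₀ = 0)
    (h2 : ∀ k : ZMod X, k ≠ v₀ → d k = d (k - 1) + 1) {i : ℕ} (hi : i < X) :
    d (v₀ + i) = i := by
  induction i with
  | zero => simpa using h0
  | succ i ih =>
    have hne : v₀ + ((i + 1 : ℕ) : ZMod X) ≠ v₀ := by
      rw [Ne, add_eq_left, ZMod.natCast_eq_zero_iff]
      exact Nat.not_dvd_of_pos_of_lt i.succ_pos hi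
    have hpred : v₀ + ((i + 1 : ℕ) : ZMod X) - 1 = v₀ + i := by push_cast; ring
    rw [h2 _ hne, hpred, ih (by omega)]

theorem ring_size_verification (X n : ℕ) (hX : 0 < X) (hn : 1 ≤ n)
    (v₀ : ZMod X) (d : ZMod X → ℕ)
    (h0 : d v₀ = 0) (h1 : d (v₀ - 1) = n - 1)
    (h2 : ∀ k : ZMod X, k ≠ v₀ → d k = d (k - 1) + 1) :
    X = n := by
  have hlast : v₀ + ((X - 1 : ℕ) : ZMod X) = v₀ - 1 := by
    rw [Nat.cast_sub hX, ZMod.natCast_self]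
    simp [sub_eq_add_neg]
  have h := ZMod.label_add_natCast h0 h2 (Nat.sub_lt hX one_pos)
  rw [hlast, h1] at h
  omega
end

section
/- Let V be a finite type with decidable equality, G : SimpleGraph V, R : ℕ, and pos : ℕ → V such that for every t < R, pos (t+1) = pos t or G.Adj (pos t) (pos (t+1)). For v : V define tin v as the finset of pairs (t+1, pos t) over those t < R with pos (t+1) = v and pos t ≠ v, and tout v as the finset of pairs (t+1, pos (t+1)) over those t < R with pos t = v and pos (t+1) ≠ v. Then for every v : V and every t ≤ R: (if pos 0 = v then 1 else 0) + (number of entries (r, u) ∈ tin v with r ≤ t : ℤ) - (number of entries (r, u) ∈ tout v with r ≤ t : ℤ) = (if pos t = v then 1 else 0). -/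
/-- In a log with one entry per selected round below `R`, the entries stamped at most `t` correspond
to the selected rounds below `t`. -/
theorem card_filter_log_le {V : Type*} [DecidableEq V] (P : ℕ → Prop) [DecidablePred P]
    (f : ℕ → V) {t R : ℕ} (ht : t ≤ R) :
    ((((Finset.range R).filter P).image (fun k => (k + 1, f k))).filter
      (fun e => e.1 ≤ t)).card = ((Finset.range t).filter P).card := by
  have hinj : Function.Injective (fun k => (k + 1, f k)) := fun a b h =>
    Nat.succ_injective (congrArg Prod.fst h)
  rw [Finset.filter_image, Finset.card_image_of_injective _ hinj]
  congr 1
  ext k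
  simp only [Finset.mem_filter, Finset.mem_range]
  constructor
  · rintro ⟨⟨-, hP⟩, hk⟩
    exact ⟨hk, hP⟩
  · rintro ⟨hk, hP⟩
    exact ⟨⟨hk.trans_le ht, hP⟩, hk⟩

/-- The number of arrivals at `v` minus the number of departures from `v` telescopes. -/
theorem indicator_add_arrivals_sub_departures {V : Type*} [DecidableEq V] (pos : ℕ → V) (v : V)
    (t : ℕ) :
    (if pos 0 = v then (1 : ℤ) else 0)
        + (((Finset.range t).filter (fun k => pos (k + 1) = v ∧ pos k ≠ v)).card : ℤ)
        - (((Finset.range t).filter (fun k => pos k = v ∧ pos (k + 1) ≠ v)).card : ℤ)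
      = (if pos t = v then 1 else 0) := by
  simp only [Finset.card_filter, Nat.cast_sum]
  induction t with
  | zero => simp
  | succ t ih =>
    rw [Finset.sum_range_succ, Finset.sum_range_succ]
    by_cases h : pos t = v <;> by_cases h' : pos (t + 1) = v <;> simp [h, h'] at ih ⊢ <;> linarith

theorem general_rpls_completeness_invariant (V : Type*) [Fintype V] [DecidableEq V]
    (G : SimpleGraph V) (R : ℕ) (pos : ℕ → V)
    (hstep : ∀ t < R, pos (t + 1) = pos t ∨ G.Adj (pos t) (pos (t + 1))) :
    let tin : V → Finset (ℕ × V) := fun v =>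
      ((Finset.range R).filter (fun k => pos (k + 1) = v ∧ pos k ≠ v)).image
        (fun k => (k + 1, pos k))
    let tout : V → Finset (ℕ × V) := fun v =>
      ((Finset.range R).filter (fun k => pos k = v ∧ pos (k + 1) ≠ v)).image
        (fun k => (k + 1, pos (k + 1)))
    ∀ v : V, ∀ t ≤ R,
      (if pos 0 = v then (1 : ℤ) else 0)
        + ((((tin v).filter (fun e => e.1 ≤ t)).card : ℤ))
        - ((((tout v).filter (fun e => e.1 ≤ t)).card : ℤ))
      = (if pos t = v then 1 else 0) := by
  intro tin tout v t ht
  rw [card_filter_log_le _ _ ht, card_filter_log_le _ (fun k => pos (k + 1)) ht]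
  exact indicator_add_arrivals_sub_departures pos v t
end
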